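/- arXiv:2407.17833 — 2 statements merged into one kernel-verified Lean document; each statement's English description precedes it below -/
import Mathlib

section
/- Let $P_1 \subseteq \mathbb{R}^n$ and $P_2 \subseteq \mathbb{R}^m$ be nonempty compact convex sets, let $c_1 \in \mathbb{R}^n$, $c_2 \in \mathbb{R}^m$ and $Q \in \mathbb{R}^{n \times m}$, and define $f(x,y) := c_1 \cdot x + c_2 \cdot y + x \cdot (Q y)$. Then there exist an extreme point $e_1$ of $P_1$ and an extreme point $e_2$ of $P_2$ such that $f(x,y) \le f(e_1,e_2)$ for all $x \in P_1$ and $y \in P_2$; i.e., the bilinear maximization over $P_1 \times P_2$ attains its maximum at a pair of extreme points. -/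
open Matrix

/-- A linear functional on a nonempty compact set attains its maximum at an extreme point. -/
theorem exists_extremePoint_forall_dotProduct_le {ι : Type*} [Fintype ι] {P : Set (ι → ℝ)}
    (hne : P.Nonempty) (hcp : IsCompact P) (a : ι → ℝ) :
    ∃ e ∈ Set.extremePoints ℝ P, ∀ x ∈ P, a ⬝ᵥ x ≤ a ⬝ᵥ e := by
  let l : StrongDual ℝ (ι → ℝ) := LinearMap.toContinuousLinearMap (dotProductBilin ℝ ℝ a)
  have hexp : IsExposed ℝ P (l.toExposed P) := ContinuousLinearMap.toExposed.isExposed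
  obtain ⟨z, hz, hmax⟩ := hcp.exists_isMaxOn hne l.continuous.continuousOn
  obtain ⟨e, he⟩ := (hexp.isCompact hcp).extremePoints_nonempty ⟨z, hz, hmax⟩
  exact ⟨e, hexp.isExtreme.extremePoints_subset_extremePoints he,
    (extremePoints_subset he).2⟩

/-- The bilinear maximization of `f(x,y) = c₁⋅x + c₂⋅y + x⋅(Qy)` over a product
of nonempty compact convex sets attains its maximum at a pair of extreme points. -/
theorem bilinear_max_at_extreme_points {n m : ℕ}
    (P1 : Set (Fin n → ℝ)) (P2 : Set (Fin m → ℝ))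
    (hP1ne : P1.Nonempty) (hP1cp : IsCompact P1) (hP1cv : Convex ℝ P1)
    (hP2ne : P2.Nonempty) (hP2cp : IsCompact P2) (hP2cv : Convex ℝ P2)
    (c1 : Fin n → ℝ) (c2 : Fin m → ℝ) (Q : Matrix (Fin n) (Fin m) ℝ) :
    ∃ e1 ∈ Set.extremePoints ℝ P1, ∃ e2 ∈ Set.extremePoints ℝ P2,
      ∀ x ∈ P1, ∀ y ∈ P2,
        c1 ⬝ᵥ x + c2 ⬝ᵥ y + x ⬝ᵥ Q.mulVec y ≤
          c1 ⬝ᵥ e1 + c2 ⬝ᵥ e2 + e1 ⬝ᵥ Q.mulVec e2 := by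
  have hcont : Continuous fun p : (Fin n → ℝ) × (Fin m → ℝ) =>
      c1 ⬝ᵥ p.1 + c2 ⬝ᵥ p.2 + p.1 ⬝ᵥ Q.mulVec p.2 := by
    fun_prop
  obtain ⟨⟨x₀, y₀⟩, ⟨hx₀, hy₀⟩, hmax⟩ :=
    (hP1cp.prod hP2cp).exists_isMaxOn (hP1ne.prod hP2ne) hcont.continuousOn
  obtain ⟨e1, he1, h1⟩ :=
    exists_extremePoint_forall_dotProduct_le hP1ne hP1cp (c1 + Q.mulVec y₀)
  obtain ⟨e2, he2, h2⟩ :=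
    exists_extremePoint_forall_dotProduct_le hP2ne hP2cp (c2 + e1 ᵥ* Q)
  refine ⟨e1, he1, e2, he2, fun x hx y hy => ?_⟩
  have hxy : c1 ⬝ᵥ x + c2 ⬝ᵥ y + x ⬝ᵥ Q.mulVec y ≤
      c1 ⬝ᵥ x₀ + c2 ⬝ᵥ y₀ + x₀ ⬝ᵥ Q.mulVec y₀ := hmax (Set.mk_mem_prod hx hy)
  have hx₀e := h1 x₀ hx₀
  have hy₀e := h2 y₀ hy₀
  rw [add_dotProduct, add_dotProduct, dotProduct_comm (Q.mulVec y₀),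
    dotProduct_comm (Q.mulVec y₀)] at hx₀e
  rw [add_dotProduct, add_dotProduct, ← dotProduct_mulVec, ← dotProduct_mulVec] at hy₀e
  linarith
end

section
/- Let $X$ be a nonempty set of decisions, let $V$ be a finite nonempty set of scenarios, and let $g : X \times V \to \mathbb{R}$. Suppose sequences $(x_k)_{k \ge 1}$ in $X$ and $(v_k)_{k \ge 1}$ in $V$ satisfy: (i) for every $k \ge 1$, $x_k$ minimizes $x \mapsto \max_{1 \le j \le k} g(x, v_j)$ over $X$; and (ii) for every $k \ge 1$, $v_{k+1}$ maximizes $v \mapsto g(x_k, v)$ over $V$. Then there exists $k \le |V|$ such that $x_k$ minimizes $x \mapsto \max_{v \in V} g(x, v)$ over $X$; i.e., the constraint generation iteration reaches a minimizer of the full min-max problem after at most $|V|$ iterations. -/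
/-- A sequence in a finite type, indexed from `1`, repeats an earlier value within its first
`Fintype.card V + 1` terms. -/
theorem exists_succ_eq_of_fintype {V : Type*} [Fintype V] (v : ℕ → V) :
    ∃ k i, 1 ≤ i ∧ i ≤ k ∧ k ≤ Fintype.card V ∧ v (k + 1) = v i := by
  obtain ⟨a, b, hab, h⟩ := Fintype.exists_ne_map_eq_of_card_lt
    (fun a : Fin (Fintype.card V + 1) => v (a + 1)) (by simp)
  wlog hlt : a < b generalizing a b
  · exact this b a hab.symm h.symm (lt_of_le_of_ne (not_lt.mp hlt) hab.symm)
  exact ⟨b, a + 1, by lia, hlt, Nat.lt_succ_iff.mp b.isLt, h.symm⟩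

/-- Finite termination of constraint generation: if each iterate `x k`
minimizes the max over the scenarios generated so far, and each new scenario
`v (k+1)` is a worst case for `x k`, then after at most `|V|` iterations some
iterate minimizes the full min-max objective over the finite scenario set `V`. -/
theorem constraint_generation_finite_termination
    {X : Type*} {V : Type*} [Nonempty X] [Fintype V] [Nonempty V]
    (g : X → V → ℝ) (x : ℕ → X) (v : ℕ → V)
    (hmain : ∀ k, ∀ hk : 1 ≤ k, ∀ x' : X,
      (Finset.Icc 1 k).sup' (Finset.nonempty_Icc.mpr hk)
          (fun j => g (x k) (v j)) ≤
        (Finset.Icc 1 k).sup' (Finset.nonempty_Icc.mpr hk)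
          (fun j => g x' (v j)))
    (hsub : ∀ k, 1 ≤ k → ∀ u : V, g (x k) u ≤ g (x k) (v (k + 1))) :
    ∃ k, 1 ≤ k ∧ k ≤ Fintype.card V ∧ ∀ x' : X,
      Finset.univ.sup' Finset.univ_nonempty (fun u => g (x k) u) ≤
        Finset.univ.sup' Finset.univ_nonempty (fun u => g x' u) := by
  obtain ⟨k, i, hi, hik, hk, hv⟩ := exists_succ_eq_of_fintype v
  have hk1 : 1 ≤ k := hi.trans hik
  refine ⟨k, hk1, hk, fun x' => ?_⟩
  calc Finset.univ.sup' Finset.univ_nonempty (fun u => g (x k) u)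
      ≤ g (x k) (v i) := Finset.sup'_le _ _ fun u _ => hv ▸ hsub k hk1 u
    _ ≤ (Finset.Icc 1 k).sup' (Finset.nonempty_Icc.mpr hk1) (fun j => g (x k) (v j)) :=
        Finset.le_sup' (fun j => g (x k) (v j)) (Finset.mem_Icc.mpr ⟨hi, hik⟩)
    _ ≤ (Finset.Icc 1 k).sup' (Finset.nonempty_Icc.mpr hk1) (fun j => g x' (v j)) :=
        hmain k hk1 x'
    _ ≤ Finset.univ.sup' Finset.univ_nonempty (fun u => g x' u) :=
        Finset.sup'_le _ _ fun j _ => Finset.le_sup' (fun u => g x' u) (Finset.mem_univ (v j))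
end
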